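/- Let A be a finite abelian group and q : A → ℚ/ℤ a non-degenerate quadratic function with underlying bilinear form B(x,y) = q(x+y) − q(x) − q(y). Let A₀ ⊆ A be a subgroup on which q vanishes identically, and A₀* its annihilator with respect to B. Then q descends to a well-defined quadratic function on A₀*/A₀, and (1/√|A|) ∑_{a ∈ A} e^{−2πi q(a)} = (1/√|A₀*/A₀|) ∑_{x ∈ A₀*/A₀} e^{−2πi q(x)}. -/

import Mathlib

/-- `ℚ/ℤ`. -/
abbrev QmodZ : Type := ℚ ⧸ AddSubgroup.zmultiples (1 : ℚ)

/-- The standard character `t ↦ e^{-2πi t}` of `ℚ/ℤ`, with values in `ℂ`. -/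
noncomputable def stdChar : QmodZ → ℂ :=
  Function.Periodic.lift (c := (1 : ℚ))
    (f := fun t : ℚ => Complex.exp (-(2 * Real.pi * Complex.I) * (t : ℂ)))
    (by
      intro t
      push_cast
      rw [mul_add, mul_one, Complex.exp_add]
      have h1 : Complex.exp (-(2 * Real.pi * Complex.I)) = 1 := by
        simpa using Complex.exp_int_mul_two_pi_mul_I (-1)
      rw [h1, mul_one])

theorem stdChar_coe (t : ℚ) :
    stdChar (t : QmodZ) = Complex.exp (-(2 * Real.pi * Complex.I) * (t : ℂ)) :=
  rfl

/-- `stdChar` as an additive character. -/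
noncomputable def stdAddChar : AddChar QmodZ ℂ where
  toFun := stdChar
  map_zero_eq_one' := by
    rw [← QuotientAddGroup.mk_zero, stdChar_coe]
    simp
  map_add_eq_mul' x y := by
    induction x using QuotientAddGroup.induction_on with | H x =>
    induction y using QuotientAddGroup.induction_on with | H y =>
    rw [← QuotientAddGroup.mk_add, stdChar_coe, stdChar_coe, stdChar_coe, ← Complex.exp_add]
    push_cast
    rw [mul_add]

theorem stdAddChar_apply (t : QmodZ) : stdAddChar t = stdChar t :=
  rfl

theorem stdAddChar_eq_one_iff (t : QmodZ) : stdAddChar t = 1 ↔ t = 0 := by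
  refine ⟨fun h => ?_, fun h => by rw [h, AddChar.map_zero_eq_one]⟩
  induction t using QuotientAddGroup.induction_on with | H t =>
  rw [stdAddChar_apply, stdChar_coe, Complex.exp_eq_one_iff] at h
  obtain ⟨n, hn⟩ := h
  have htn : (t : ℂ) = ((-n : ℤ) : ℂ) := by
    apply mul_left_cancel₀ Complex.two_pi_I_ne_zero
    push_cast
    linear_combination -hn
  have htn' : t = ((-n : ℤ) : ℚ) := by exact_mod_cast htn
  rw [QuotientAddGroup.eq_zero_iff, AddSubgroup.mem_zmultiples_iff]
  exact ⟨-n, by simp [htn']⟩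

open Classical in
/-- Orthogonality relation for the character of a finite group attached to a homomorphism to
`ℚ/ℤ`. -/
theorem sum_stdAddChar_comp {H : Type*} [AddCommGroup H] [Fintype H] (φ : H →+ QmodZ) :
    ∑ h, stdAddChar (φ h) = if ∀ h, φ h = 0 then (Fintype.card H : ℂ) else 0 := by
  have key := AddChar.sum_eq_ite (stdAddChar.compAddMonoidHom φ)
  have hiff : stdAddChar.compAddMonoidHom φ = 0 ↔ ∀ h, φ h = 0 := by
    rw [AddChar.ext_iff]
    simp [stdAddChar_eq_one_iff]
  simpa only [AddChar.compAddMonoidHom_apply, hiff] using key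

/-- Summing an `A₀`-invariant function over `K`, given a set `S` of representatives of `K / A₀`. -/
theorem sum_eq_card_mul_sum_representatives {A : Type*} [AddCommGroup A]
    (A₀ K : AddSubgroup A) [Fintype A₀] [Fintype K] (hA₀ : A₀ ≤ K) (S : Finset A)
    (hS₁ : ∀ s ∈ S, s ∈ K) (hS₂ : ∀ y ∈ K, ∃! s, s ∈ S ∧ y - s ∈ A₀)
    (f : A → ℂ) (hf : ∀ x ∈ K, ∀ a ∈ A₀, f (x + a) = f x) :
    ∑ y : K, f y = Fintype.card A₀ * ∑ s ∈ S, f s := by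
  have h : ∑ p ∈ S ×ˢ (Finset.univ : Finset A₀), f p.1 = ∑ y : K, f y := by
    refine Finset.sum_bij
      (fun p hp => ⟨p.1 + p.2, K.add_mem (hS₁ _ (Finset.mem_product.1 hp).1) (hA₀ p.2.2)⟩)
      (fun _ _ => Finset.mem_univ _) ?_ ?_ ?_
    · rintro ⟨s, a⟩ hs ⟨t, b⟩ ht hst
      replace hs : s ∈ S := (Finset.mem_product.1 hs).1
      replace ht : t ∈ S := (Finset.mem_product.1 ht).1
      replace hst : s + (a : A) = t + b := congrArg Subtype.val hst
      have hs_eq : s = t :=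
        (hS₂ (s + a) (K.add_mem (hS₁ s hs) (hA₀ a.2))).unique
          ⟨hs, by simp⟩ ⟨ht, by simp [hst]⟩
      subst hs_eq
      rw [Subtype.ext (add_left_cancel hst)]
    · rintro ⟨y, hy⟩ -
      obtain ⟨s, ⟨hs, hys⟩, -⟩ := hS₂ y hy
      exact ⟨(s, ⟨y - s, hys⟩), by simp [hs], by simp⟩
    · rintro ⟨s, a⟩ hs
      exact (hf s (hS₁ s (Finset.mem_product.1 hs).1) a a.2).symm
  rw [← h, Finset.sum_product, Finset.mul_sum]
  simp

open Classical in
/-- Averaging over a subgroup `A₀` detects its annihilator. -/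
theorem sum_mul_sum_stdAddChar {A : Type*} [AddCommGroup A] [Fintype A]
    (β : A →+ A →+ QmodZ) (A₀ K : AddSubgroup A) (hK : ∀ x, x ∈ K ↔ ∀ a ∈ A₀, β x a = 0)
    (f : A → ℂ) :
    ∑ x, f x * ∑ a : A₀, stdAddChar (β x a) = Fintype.card A₀ * ∑ x : K, f x := by
  have horth (x : A) : ∑ a : A₀, stdAddChar (β x a) =
      if x ∈ K then (Fintype.card A₀ : ℂ) else 0 := by
    have h := sum_stdAddChar_comp ((β x).comp A₀.subtype)
    simpa [hK] using h
  simp_rw [horth, mul_ite, mul_zero]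
  rw [← Finset.sum_filter, ← Finset.sum_mul, mul_comm,
    Finset.sum_subtype _ (p := (· ∈ K)) (by simp)]

open Classical in
/-- A subgroup and its annihilator under a non-degenerate pairing have complementary orders. -/
theorem card_mul_card_annihilator {A : Type*} [AddCommGroup A] [Fintype A]
    (β : A →+ A →+ QmodZ) (hβ : ∀ y, (∀ x, β x y = 0) → y = 0)
    (A₀ K : AddSubgroup A) (hK : ∀ x, x ∈ K ↔ ∀ a ∈ A₀, β x a = 0) :
    (Fintype.card A₀ * Fintype.card K : ℂ) = Fintype.card A := by
  have h := sum_mul_sum_stdAddChar β A₀ K hK (fun _ => 1)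
  have horth (a : A₀) : ∑ x, stdAddChar (β x a) = if a = 0 then (Fintype.card A : ℂ) else 0 := by
    have hiff : (∀ x, β x a = 0) ↔ a = 0 :=
      ⟨fun h => Subtype.ext (hβ _ h), fun h => by simp [h]⟩
    simpa [hiff] using sum_stdAddChar_comp (β.flip a)
  simp only [one_mul] at h
  rw [Finset.sum_comm] at h
  simp_rw [horth] at h
  simpa using h.symm

/-- Let `A` be a finite abelian group and `q : A → ℚ/ℤ` a non-degenerate
quadratic function with underlying bilinear form `B x y = q(x+y) - q x - q y`.  Let `A₀` be a
subgroup on which `q` vanishes, and `Astar` its annihilator with respect to `B`.  Then `q`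
descends to `Astar/A₀` (i.e. `q (x + a) = q x` for `x ∈ Astar`, `a ∈ A₀`), and, with `S` a
complete set of representatives of `Astar/A₀`,
`|A|^{-1/2} ∑_{a ∈ A} e^{-2πi q a} = |Astar/A₀|^{-1/2} ∑_{x ∈ Astar/A₀} e^{-2πi q x}`. -/
theorem statement5 (A : Type*) [AddCommGroup A] [Fintype A]
    (q : A → QmodZ)
    (B : A → A → QmodZ)
    (hB : ∀ x y : A, B x y = q (x + y) - q x - q y)
    (haddl : ∀ x y z : A, B (x + y) z = B x z + B y z)
    (haddr : ∀ x y z : A, B x (y + z) = B x y + B x z)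
    (hnondeg : ∀ x : A, (∀ y : A, B x y = 0) → x = 0)
    (hq0 : q 0 = 0)
    (A₀ : AddSubgroup A)
    (hqA₀ : ∀ a ∈ A₀, q a = 0)
    (Astar : AddSubgroup A)
    (hAstar : ∀ x : A, x ∈ Astar ↔ ∀ a ∈ A₀, B x a = 0)
    (S : Finset A)
    (hS₁ : ∀ s ∈ S, s ∈ Astar)
    (hS₂ : ∀ y ∈ Astar, ∃! s, s ∈ S ∧ y - s ∈ A₀) :
    (∀ x ∈ Astar, ∀ a ∈ A₀, q (x + a) = q x) ∧
    ((Real.sqrt (Fintype.card A) : ℂ)⁻¹ * ∑ a : A, stdChar (q a)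
      = (Real.sqrt S.card : ℂ)⁻¹ * ∑ s ∈ S, stdChar (q s)) := by
  classical
  have hdesc : ∀ x ∈ Astar, ∀ a ∈ A₀, q (x + a) = q x := by
    intro x hx a ha
    have h := hB x a
    rw [(hAstar x).1 hx a ha, hqA₀ a ha, sub_zero] at h
    exact (sub_eq_zero.1 h.symm)
  refine ⟨hdesc, ?_⟩
  have hsymm (x y : A) : B x y = B y x := by rw [hB, hB, add_comm x y, sub_right_comm]
  let β : A →+ A →+ QmodZ :=
    AddMonoidHom.mk' (fun x => AddMonoidHom.mk' (B x) (haddr x))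
      fun x y => AddMonoidHom.ext (haddl x y)
  have hβ (x y : A) : β x y = B x y := rfl
  have hle : A₀ ≤ Astar := fun x hx => (hAstar x).2 fun a ha => by
    rw [hB, hqA₀ _ (A₀.add_mem hx ha), hqA₀ x hx, hqA₀ a ha, sub_zero, sub_zero]
  have hcard := card_mul_card_annihilator β
    (fun y h => hnondeg y fun x => by rw [hsymm, ← hβ, h]) A₀ Astar hAstar
  have hcardStar := sum_eq_card_mul_sum_representatives A₀ Astar hle S hS₁ hS₂ (fun _ => 1)
    fun _ _ _ _ => rfl
  have hsumStar := sum_eq_card_mul_sum_representatives A₀ Astar hle S hS₁ hS₂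
    (fun x => stdChar (q x)) fun x hx a ha => by rw [hdesc x hx a ha]
  have hdetect := sum_mul_sum_stdAddChar β A₀ Astar hAstar (fun x => stdChar (q x))
  have htranslate (a : A₀) :
      ∑ x, stdChar (q x) * stdAddChar (β x a) = ∑ x, stdChar (q x) := by
    rw [← Equiv.sum_comp (Equiv.addRight (a : A)) fun x => stdChar (q x)]
    refine Finset.sum_congr rfl fun x _ => ?_
    have hqx : q (x + a) = q x + B x a := by rw [hB, hqA₀ a a.2]; abel
    rw [Equiv.coe_addRight, hqx, ← stdAddChar_apply, ← stdAddChar_apply, AddChar.map_add_eq_mul, hβ]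
  have hA₀ne : (Fintype.card A₀ : ℂ) ≠ 0 := Nat.cast_ne_zero.2 Fintype.card_ne_zero
  have hsum : ∑ x, stdChar (q x) = Fintype.card A₀ * ∑ s ∈ S, stdChar (q s) := by
    simp_rw [Finset.mul_sum Finset.univ] at hdetect
    rw [Finset.sum_comm] at hdetect
    simp_rw [htranslate] at hdetect
    rw [Finset.sum_const, Finset.card_univ, nsmul_eq_mul, ← Finset.mul_sum] at hdetect
    rw [mul_left_cancel₀ hA₀ne hdetect, hsumStar]
  have hcardA : (Fintype.card A : ℝ) = (Fintype.card A₀ : ℝ) ^ 2 * S.card := by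
    simp only [Finset.sum_const, Finset.card_univ, nsmul_eq_mul, mul_one] at hcardStar
    rw [hcardStar] at hcard
    rw [pow_two, mul_assoc]
    exact_mod_cast hcard.symm
  rw [hsum, hcardA, Real.sqrt_mul (by positivity), Real.sqrt_sq (by positivity)]
  rw [Complex.ofReal_mul, Complex.ofReal_natCast, mul_inv_rev, mul_assoc,
    inv_mul_cancel_left₀ hA₀ne]
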